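/- arXiv:2102.07078 — 3 statements merged into one kernel-verified Lean document; each statement's English description precedes it below -/
import Mathlib

section
/- Let n, d, N, k be positive integers and let 𝒜 : ℝ^{n×d} → ℝ^N be a linear map satisfying the 2k-restricted isometry property with constant δ_{2k} ∈ [0,1). Then for any n×d real matrix X of rank at most k, ‖𝒜*𝒜(X) − X‖₂ ≤ δ_{2k} · ‖X‖_F, where ‖·‖₂ is the spectral norm of an n×d matrix and 𝒜* is the adjoint of 𝒜. -/
open Matrix MeasureTheory ProbabilityTheory
open scoped RealInnerProductSpace BigOperators

/-- Frobenius norm of a real matrix. -/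
noncomputable def frobNorm {m n : ℕ} (M : Matrix (Fin m) (Fin n) ℝ) : ℝ :=
  Real.sqrt (∑ i, ∑ j, M i j ^ 2)

/-- Spectral (ℓ²-operator) norm of a real matrix. -/
noncomputable def specNorm {m n : ℕ} (M : Matrix (Fin m) (Fin n) ℝ) : ℝ :=
  ‖LinearMap.toContinuousLinearMap (Matrix.toEuclideanLin M)‖

/-- Principal-angle distance between the column spans of two `d × k` matrices
with orthonormal columns: `dist(B, B*) = ‖B*ᵀ (B Bᵀ - I)‖₂`. -/
noncomputable def pdist {d k : ℕ} (B Bstar : Matrix (Fin d) (Fin k) ℝ) : ℝ :=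
  specNorm (Bstarᵀ * (B * Bᵀ - 1))

/-- The `k`-restricted isometry property with constant `δ` for a linear map from
`n × d` matrices to `ℝ^N`. -/
def RIP {n d N : ℕ} (A : Matrix (Fin n) (Fin d) ℝ →ₗ[ℝ] EuclideanSpace ℝ (Fin N))
    (k : ℕ) (δ : ℝ) : Prop :=
  ∀ M : Matrix (Fin n) (Fin d) ℝ, M.rank ≤ k →
    (1 - δ) * frobNorm M ^ 2 ≤ ‖A M‖ ^ 2 ∧ ‖A M‖ ^ 2 ≤ (1 + δ) * frobNorm M ^ 2

theorem frobSq {m n : ℕ} (M : Matrix (Fin m) (Fin n) ℝ) :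
    frobNorm M ^ 2 = ∑ i, ∑ j, M i j ^ 2 := by
  unfold frobNorm
  exact Real.sq_sqrt (Finset.sum_nonneg fun i _ => Finset.sum_nonneg fun j _ => sq_nonneg _)

theorem trInner {m n : ℕ} (M P : Matrix (Fin m) (Fin n) ℝ) :
    Matrix.trace (Mᵀ * P) = ∑ i, ∑ j, M i j * P i j := by
  simp only [Matrix.trace, Matrix.diag, Matrix.mul_apply, Matrix.transpose_apply]
  exact Finset.sum_comm

theorem frobExp {m n : ℕ} (M P : Matrix (Fin m) (Fin n) ℝ) (t : ℝ) :
    frobNorm (M + t • P) ^ 2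
      = frobNorm M ^ 2 + 2 * t * Matrix.trace (Pᵀ * M) + t ^ 2 * frobNorm P ^ 2 := by
  simp only [frobSq, trInner, Finset.mul_sum, ← Finset.sum_add_distrib]
  refine Finset.sum_congr rfl fun i _ => Finset.sum_congr rfl fun j _ => ?_
  simp only [Matrix.add_apply, Matrix.smul_apply, smul_eq_mul]
  ring

theorem frobVec {m n : ℕ} (w : Fin m → ℝ) (v : Fin n → ℝ) :
    frobNorm (Matrix.vecMulVec w v) ^ 2 = (∑ i, w i ^ 2) * ∑ j, v j ^ 2 := by
  rw [frobSq, Finset.sum_mul_sum]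
  simp only [Matrix.vecMulVec_apply, mul_pow]

theorem trVec {m n : ℕ} (w : Fin m → ℝ) (v : Fin n → ℝ) (E : Matrix (Fin m) (Fin n) ℝ) :
    Matrix.trace ((Matrix.vecMulVec w v)ᵀ * E) = ∑ i, w i * (E *ᵥ v) i := by
  rw [trInner]
  simp only [Matrix.vecMulVec_apply, Matrix.mulVec, dotProduct, Finset.mul_sum]
  refine Finset.sum_congr rfl fun i _ => Finset.sum_congr rfl fun j _ => ?_
  ring

theorem matRankAdd {m n : ℕ} (M P : Matrix (Fin m) (Fin n) ℝ) :
    (M + P).rank ≤ M.rank + P.rank := by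
  unfold Matrix.rank
  rw [Matrix.mulVecLin_add]
  refine (Submodule.finrank_mono ?_).trans (Submodule.finrank_add_le_finrank_add_finrank _ _)
  rintro _ ⟨x, rfl⟩
  exact Submodule.add_mem_sup ⟨x, rfl⟩ ⟨x, rfl⟩

theorem stmt1 {n d N k : ℕ} (hn : 0 < n) (hd : 0 < d) (hN : 0 < N) (hk : 0 < k)
    (A : Matrix (Fin n) (Fin d) ℝ →ₗ[ℝ] EuclideanSpace ℝ (Fin N))
    (Astar : EuclideanSpace ℝ (Fin N) →ₗ[ℝ] Matrix (Fin n) (Fin d) ℝ)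
    (hadj : ∀ (M : Matrix (Fin n) (Fin d) ℝ) (y : EuclideanSpace ℝ (Fin N)),
      ⟪A M, y⟫ = Matrix.trace (Mᵀ * Astar y))
    (δ : ℝ) (hδ0 : 0 ≤ δ) (hδ1 : δ < 1) (hRIP : RIP A (2 * k) δ)
    (X : Matrix (Fin n) (Fin d) ℝ) (hX : X.rank ≤ k) :
    specNorm (Astar (A X) - X) ≤ δ * frobNorm X := by
  have key : ∀ Y : Matrix (Fin n) (Fin d) ℝ, Y.rank ≤ 1 →
      (Matrix.trace (Yᵀ * (Astar (A X) - X))) ^ 2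
        ≤ δ ^ 2 * frobNorm X ^ 2 * frobNorm Y ^ 2 := by
    intro Y hY
    set b := Matrix.trace (Yᵀ * (Astar (A X) - X)) with hb
    have hb' : b = ⟪A Y, A X⟫ - Matrix.trace (Yᵀ * X) := by
      rw [hb, Matrix.mul_sub, Matrix.trace_sub, hadj]
    have hrank : ∀ t : ℝ, (X + t • Y).rank ≤ 2 * k := by
      intro t
      have h1 := matRankAdd X (t • Y)
      have h2 : (t • Y).rank ≤ Y.rank := by
        have : t • Y = Y * (t • (1 : Matrix (Fin d) (Fin d) ℝ)) := by simp
        rw [this]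
        exact Matrix.rank_mul_le_left _ _
      omega
    have hA : ∀ t : ℝ, ‖A (X + t • Y)‖ ^ 2
        = ‖A X‖ ^ 2 + 2 * t * ⟪A Y, A X⟫ + t ^ 2 * ‖A Y‖ ^ 2 := by
      intro t
      rw [map_add, map_smul, norm_add_sq_real, inner_smul_right, norm_smul, mul_pow,
        Real.norm_eq_abs, sq_abs, real_inner_comm]
      ring
    have hq : ∀ t : ℝ, 0 ≤ (δ * frobNorm Y ^ 2) * (t * t) + (-2 * b) * t + δ * frobNorm X ^ 2 := by
      intro t
      have h1 := (hRIP _ (hrank t)).2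
      have h2 := (hRIP _ (hrank (-t))).1
      rw [hA, frobExp] at h1 h2
      rw [hb']
      nlinarith
    have := discrim_le_zero hq
    unfold discrim at this
    nlinarith
  unfold specNorm
  have hF : 0 ≤ frobNorm X := Real.sqrt_nonneg _
  refine ContinuousLinearMap.opNorm_le_bound _ (mul_nonneg hδ0 hF) fun v => ?_
  set E := Astar (A X) - X with hE
  have h := key (Matrix.vecMulVec (E *ᵥ v.ofLp) v.ofLp) (Matrix.rank_vecMulVec_le _ _)
  rw [trVec, frobVec] at h
  have hv : ‖v‖ ^ 2 = ∑ j, v.ofLp j ^ 2 := EuclideanSpace.real_norm_sq_eq v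
  have hw : ‖(LinearMap.toContinuousLinearMap (Matrix.toEuclideanLin E)) v‖ ^ 2
      = ∑ i, (E *ᵥ v.ofLp) i ^ 2 := by
    rw [EuclideanSpace.real_norm_sq_eq]
    rfl
  simp only [← pow_two] at h
  rw [← hv, ← hw] at h
  set s := ‖(LinearMap.toContinuousLinearMap (Matrix.toEuclideanLin E)) v‖
  have hs : 0 ≤ s := norm_nonneg _
  have hc : 0 ≤ δ * frobNorm X * ‖v‖ := by positivity
  rcases hs.eq_or_lt with h0 | h0
  · rw [← h0]; exact hc
  · refine (pow_le_pow_iff_left₀ hs hc two_ne_zero).1 ?_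
    have hs2 : 0 < s ^ 2 := by positivity
    refine le_of_mul_le_mul_left ?_ hs2
    nlinarith
end

section
/- Let n, d, N, k be positive integers and let 𝒜 : ℝ^{n×d} → ℝ^N be a linear map satisfying the 2k-restricted isometry property with constant δ_{2k} ∈ [0,1). Then for any n×d real matrix X of rank at most k, ‖𝒜*𝒜(X)‖₂ ≤ (1 + √k · δ_{2k}) · ‖X‖₂, where ‖·‖₂ is the spectral norm. -/
open Matrix MeasureTheory ProbabilityTheory
open scoped RealInnerProductSpace BigOperators

lemma frob_sq {m n : ℕ} (M : Matrix (Fin m) (Fin n) ℝ) :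
    frobNorm M ^ 2 = Matrix.trace (Mᵀ * M) := by
  unfold frobNorm
  rw [Real.sq_sqrt (by positivity)]
  simp only [Matrix.trace, Matrix.diag, Matrix.mul_apply, Matrix.transpose_apply]
  rw [Finset.sum_comm]
  simp [sq]

lemma frob_zero {m n : ℕ} (M : Matrix (Fin m) (Fin n) ℝ) (h : frobNorm M = 0) : M = 0 := by
  have h2 := frob_sq M
  rw [h] at h2
  apply Matrix.trace_conjTranspose_mul_self_eq_zero_iff.mp
  rw [Matrix.conjTranspose_eq_transpose_of_trivial, ← h2]; norm_num

lemma spec_bound {m n : ℕ} (M : Matrix (Fin m) (Fin n) ℝ) (v : EuclideanSpace ℝ (Fin n)) :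
    ‖Matrix.toEuclideanLin M v‖ ≤ specNorm M * ‖v‖ :=
  (LinearMap.toContinuousLinearMap (Matrix.toEuclideanLin M)).le_opNorm v

lemma frob_le {m n k : ℕ} (M : Matrix (Fin m) (Fin n) ℝ) (h : M.rank ≤ k) :
    frobNorm M ≤ Real.sqrt k * specNorm M := by
  have hs : 0 ≤ specNorm M := norm_nonneg _
  refine abs_le_of_sq_le_sq' ?_ (by positivity) |>.2
  rw [mul_pow, Real.sq_sqrt (by positivity), frob_sq]
  have hH : (Mᵀ * M).IsHermitian := by
    simpa using Matrix.isHermitian_conjTranspose_mul_self M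
  rw [hH.trace_eq_sum_eigenvalues]
  have hb : ∀ i, hH.eigenvalues i ≤ specNorm M ^ 2 := by
    intro i
    have h1 := spec_bound M (hH.eigenvectorBasis i)
    rw [(hH.eigenvectorBasis).orthonormal.1 i, mul_one] at h1
    have h2 : hH.eigenvalues i = ‖Matrix.toEuclideanLin M (hH.eigenvectorBasis i)‖ ^ 2 := by
      rw [hH.eigenvalues_eq, ← Matrix.mulVec_mulVec, Matrix.dotProduct_mulVec,
        Matrix.vecMul_transpose, EuclideanSpace.norm_sq_eq]
      simp [dotProduct, sq, Matrix.toEuclideanLin]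
    rw [h2]
    gcongr
  have hc := hH.rank_eq_card_non_zero_eigs
  rw [Matrix.rank_transpose_mul_self, Fintype.card_subtype] at hc
  calc _ = ∑ i, hH.eigenvalues i := by simp
    _ = ∑ i with hH.eigenvalues i ≠ 0, hH.eigenvalues i := by
        rw [Finset.sum_filter_ne_zero]
    _ ≤ (Finset.card {i | hH.eigenvalues i ≠ 0}) • specNorm M ^ 2 :=
        Finset.sum_le_card_nsmul _ _ _ fun i _ => hb i
    _ ≤ k * specNorm M ^ 2 := by
        rw [nsmul_eq_mul, ← hc]
        gcongr

lemma rank_add_le_aux {m n : ℕ} (M X : Matrix (Fin m) (Fin n) ℝ) :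
    (M + X).rank ≤ M.rank + X.rank := by
  unfold Matrix.rank
  refine le_trans (Submodule.finrank_mono ?_)
    (Submodule.finrank_add_le_finrank_add_finrank (LinearMap.range M.mulVecLin)
      (LinearMap.range X.mulVecLin))
  rintro _ ⟨v, rfl⟩
  rw [Matrix.mulVecLin_add]
  exact Submodule.add_mem_sup ⟨v, rfl⟩ ⟨v, rfl⟩

lemma rip_inner {n d N k : ℕ}
    (A : Matrix (Fin n) (Fin d) ℝ →ₗ[ℝ] EuclideanSpace ℝ (Fin N))
    (δ : ℝ) (hRIP : RIP A (2 * k) δ)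
    (M X : Matrix (Fin n) (Fin d) ℝ) (hM : M.rank ≤ k) (hX : X.rank ≤ k) :
    ⟪A M, A X⟫ ≤ Matrix.trace (Mᵀ * X) + δ * (frobNorm M * frobNorm X) := by
  have ha0 : 0 ≤ frobNorm M := Real.sqrt_nonneg _
  have hb0 : 0 ≤ frobNorm X := Real.sqrt_nonneg _
  rcases ha0.eq_or_lt with ha | ha
  · have := frob_zero M ha.symm
    subst this
    simp [← ha]
  rcases hb0.eq_or_lt with hb | hb
  · have := frob_zero X hb.symm
    subst this
    simp [← hb]
  have hsm : ∀ (c : ℝ) (Y : Matrix (Fin n) (Fin d) ℝ), Y.rank ≤ k → (c • Y).rank ≤ k := by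
    intro c Y hY
    have : c • Y = (c • (1 : Matrix (Fin n) (Fin n) ℝ)) * Y := by simp
    rw [this]
    exact (Matrix.rank_mul_le_right _ _).trans hY
  have key : ∀ s t : ℝ, s * t * ⟪A M, A X⟫ ≤ s * t * Matrix.trace (Mᵀ * X) +
      δ / 2 * (s ^ 2 * frobNorm M ^ 2 + t ^ 2 * frobNorm X ^ 2) := by
    intro s t
    have r1 : (s • M + t • X).rank ≤ 2 * k :=
      (rank_add_le_aux _ _).trans (by have := hsm s M hM; have := hsm t X hX; omega)
    have r2 : (s • M + (-t) • X).rank ≤ 2 * k :=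
      (rank_add_le_aux _ _).trans (by have := hsm s M hM; have := hsm (-t) X hX; omega)
    have h1 := (hRIP _ r1).2
    have h2 := (hRIP _ r2).1
    have hf : ∀ t : ℝ, frobNorm (s • M + t • X) ^ 2 = s ^ 2 * frobNorm M ^ 2 +
        2 * (s * t) * Matrix.trace (Mᵀ * X) + t ^ 2 * frobNorm X ^ 2 := by
      intro t
      have hsym : Matrix.trace (Xᵀ * M) = Matrix.trace (Mᵀ * X) := by
        rw [← Matrix.trace_transpose]; simp
      simp only [frob_sq, Matrix.transpose_add, Matrix.transpose_smul, Matrix.add_mul,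
        Matrix.mul_add, Matrix.trace_add, Matrix.smul_mul, Matrix.mul_smul, Matrix.trace_smul,
        smul_eq_mul, hsym]
      ring
    have hA : ∀ t : ℝ, ‖A (s • M + t • X)‖ ^ 2 = s ^ 2 * ‖A M‖ ^ 2 +
        2 * (s * t) * ⟪A M, A X⟫ + t ^ 2 * ‖A X‖ ^ 2 := by
      intro t
      rw [map_add, map_smul, map_smul, norm_add_sq_real, norm_smul, norm_smul,
        real_inner_smul_left, real_inner_smul_right, mul_pow, mul_pow, Real.norm_eq_abs,
        Real.norm_eq_abs, sq_abs, sq_abs]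
      ring
    rw [hf, hA] at h1 h2
    nlinarith
  have := key (frobNorm X) (frobNorm M)
  have hp : 0 < frobNorm X * frobNorm M := by positivity
  refine le_of_mul_le_mul_left ?_ hp
  nlinarith

theorem stmt2 {n d N k : ℕ} (hn : 0 < n) (hd : 0 < d) (hN : 0 < N) (hk : 0 < k)
    (A : Matrix (Fin n) (Fin d) ℝ →ₗ[ℝ] EuclideanSpace ℝ (Fin N))
    (Astar : EuclideanSpace ℝ (Fin N) →ₗ[ℝ] Matrix (Fin n) (Fin d) ℝ)
    (hadj : ∀ (M : Matrix (Fin n) (Fin d) ℝ) (y : EuclideanSpace ℝ (Fin N)),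
      ⟪A M, y⟫ = Matrix.trace (Mᵀ * Astar y))
    (δ : ℝ) (hδ0 : 0 ≤ δ) (hδ1 : δ < 1) (hRIP : RIP A (2 * k) δ)
    (X : Matrix (Fin n) (Fin d) ℝ) (hX : X.rank ≤ k) :
    specNorm (Astar (A X)) ≤ (1 + Real.sqrt k * δ) * specNorm X := by
  have hs : 0 ≤ specNorm X := norm_nonneg _
  apply ContinuousLinearMap.opNorm_le_bound _ (by positivity)
  intro y
  change ‖Matrix.toEuclideanLin (Astar (A X)) y‖ ≤ _
  set x := Matrix.toEuclideanLin (Astar (A X)) y with hx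
  have htr : ∀ Z : Matrix (Fin n) (Fin d) ℝ,
      Matrix.trace ((Matrix.vecMulVec x.ofLp y.ofLp)ᵀ * Z) = ⟪x, Matrix.toEuclideanLin Z y⟫ := by
    intro Z
    rw [Matrix.transpose_vecMulVec, Matrix.vecMulVec_mul, Matrix.trace_vecMulVec,
      dotProduct_comm, ← Matrix.dotProduct_mulVec]
    simp [PiLp.inner_apply, dotProduct, Matrix.toEuclideanLin, mul_comm]
  have hfr : frobNorm (Matrix.vecMulVec x.ofLp y.ofLp) = ‖x‖ * ‖y‖ := by
    unfold frobNorm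
    rw [Real.sqrt_eq_iff_mul_self_eq (by positivity) (by positivity), ← sq, mul_pow,
      EuclideanSpace.norm_sq_eq, EuclideanSpace.norm_sq_eq, Finset.sum_mul_sum]
    simp [Matrix.vecMulVec_apply, mul_pow]
  have h := rip_inner A δ hRIP (Matrix.vecMulVec x.ofLp y.ofLp) X
    ((Matrix.rank_vecMulVec_le _ _).trans hk) hX
  rw [hadj, htr, htr, ← hx, hfr, real_inner_self_eq_norm_sq] at h
  have h1 := real_inner_le_norm x (Matrix.toEuclideanLin X y)
  have h2 := spec_bound X y
  have h3 := frob_le X hX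
  have h4 : ‖x‖ * ‖x‖ ≤ ‖x‖ * ((1 + Real.sqrt k * δ) * specNorm X * ‖y‖) := by
    have e1 : ‖x‖ * ‖Matrix.toEuclideanLin X y‖ ≤ ‖x‖ * (specNorm X * ‖y‖) := by gcongr
    have e2 : δ * (‖x‖ * ‖y‖ * frobNorm X) ≤ δ * (‖x‖ * ‖y‖ * (Real.sqrt k * specNorm X)) := by
      gcongr
    nlinarith
  rcases (norm_nonneg x).eq_or_lt with h0 | h0
  · rw [← h0]; positivity
  · exact le_of_mul_le_mul_left h4 h0
end

section
/- Let n, d, k be positive integers with k ≤ d and k ≥ 1. Let Û ∈ ℝ^{n×k}, let V ∈ ℝ^{d×k} have orthonormal columns, let P ∈ ℝ^{d×(d−k)} have orthonormal columns, and let x ∈ ℝ^k be a unit vector. Then tr( P Pᵀ V x xᵀ Ûᵀ Û Vᵀ ) ≥ σ_min²(Û) · ‖Pᵀ V‖₂² − √(k−1) · ‖Û‖_F² · ‖Pᵀ V‖₂², where σ_min(Û) is the smallest singular value of Û, ‖·‖₂ is the spectral norm and ‖·‖_F is the Frobenius norm. -/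
open Matrix MeasureTheory ProbabilityTheory
open scoped RealInnerProductSpace BigOperators

/-- Square of the smallest singular value of an `n × k` real matrix `W`,
i.e. the smallest eigenvalue of `Wᵀ W`. -/
noncomputable def sigMinSq {n k : ℕ} (W : Matrix (Fin n) (Fin k) ℝ) : ℝ :=
  sInf (spectrum ℝ (Wᵀ * W))

lemma aux_trace {n d k m : ℕ} (U : Matrix (Fin n) (Fin k) ℝ) (V : Matrix (Fin d) (Fin k) ℝ)
    (P : Matrix (Fin d) (Fin m) ℝ) (x : Fin k → ℝ) :
    Matrix.trace (P * Pᵀ * V * Matrix.vecMulVec x x * Uᵀ * U * Vᵀ) =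
      ((Pᵀ * V) *ᵥ ((Uᵀ * U) *ᵥ x)) ⬝ᵥ ((Pᵀ * V) *ᵥ x) := by
  have h1 : P * Pᵀ * V * Matrix.vecMulVec x x * Uᵀ * U * Vᵀ =
      Matrix.vecMulVec ((P * Pᵀ * V) *ᵥ x) ((V * (Uᵀ * U)) *ᵥ x) := by
    rw [Matrix.mul_vecMulVec, Matrix.vecMulVec_mul, Matrix.vecMulVec_mul, Matrix.vecMulVec_mul]
    congr 1
    rw [Matrix.vecMul_vecMul, Matrix.vecMul_vecMul, ← Matrix.mulVec_transpose]
    simp [Matrix.transpose_mul, Matrix.mul_assoc]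
  rw [h1, Matrix.trace_vecMulVec, dotProduct_comm]
  simp only [← Matrix.mulVec_mulVec]
  rw [Matrix.dotProduct_mulVec, ← Matrix.mulVec_transpose]

lemma aux_frob {n k : ℕ} (U : Matrix (Fin n) (Fin k) ℝ) :
    frobNorm U ^ 2 = Matrix.trace (Uᵀ * U) := by
  unfold frobNorm
  rw [Real.sq_sqrt (by positivity), Finset.sum_comm]
  simp [Matrix.trace, Matrix.mul_apply, sq]

lemma aux_herm {n k : ℕ} (U : Matrix (Fin n) (Fin k) ℝ) : (Uᵀ * U).PosSemidef := by
  have := Matrix.posSemidef_conjTranspose_mul_self U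
  rwa [Matrix.conjTranspose_eq_transpose_of_trivial] at this

lemma aux_sig {n k : ℕ} (U : Matrix (Fin n) (Fin k) ℝ) (i : Fin k) :
    sigMinSq U ≤ (aux_herm U).isHermitian.eigenvalues i := by
  unfold sigMinSq
  apply csInf_le (Matrix.finite_real_spectrum).bddBelow
  exact (aux_herm U).isHermitian.eigenvalues_mem_spectrum_real i

lemma aux_tr {n k : ℕ} (U : Matrix (Fin n) (Fin k) ℝ) :
    frobNorm U ^ 2 = ∑ i, (aux_herm U).isHermitian.eigenvalues i := by
  rw [aux_frob, (aux_herm U).isHermitian.trace_eq_sum_eigenvalues]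
  simp

lemma aux_spec {m k : ℕ} (W : Matrix (Fin m) (Fin k) ℝ) (x : Fin k → ℝ) :
    ‖WithLp.toLp 2 (W *ᵥ x)‖ ≤ specNorm W * ‖WithLp.toLp 2 x‖ := by
  have := (LinearMap.toContinuousLinearMap (Matrix.toEuclideanLin W)).le_opNorm (WithLp.toLp 2 x)
  simpa [specNorm, Matrix.toLpLin_toLp] using this

lemma aux_eig {k : ℕ} (A : Matrix (Fin k) (Fin k) ℝ) (hA : A.PosSemidef) (L : ℝ)
    (hL : ∀ i, hA.isHermitian.eigenvalues i ≤ L) (hL0 : 0 ≤ L) (x : Fin k → ℝ) :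
    ‖WithLp.toLp 2 (A *ᵥ x)‖ ≤ L * ‖WithLp.toLp 2 x‖ := by
  set b := hA.isHermitian.eigenvectorBasis with hb
  apply le_of_sq_le_sq _ (by positivity)
  rw [mul_pow, ← b.sum_sq_norm_inner_right, ← b.sum_sq_norm_inner_right, Finset.mul_sum]
  refine Finset.sum_le_sum fun i _ => ?_
  have h : inner ℝ (b i) (WithLp.toLp 2 (A *ᵥ x)) =
      hA.isHermitian.eigenvalues i * inner ℝ (b i) (WithLp.toLp 2 x) := by
    have h2 := hA.isHermitian.mulVec_eigenvectorBasis i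
    have hT : Aᵀ = A := by
      simpa [Matrix.conjTranspose_eq_transpose_of_trivial] using hA.isHermitian.eq
    rw [EuclideanSpace.inner_eq_star_dotProduct, EuclideanSpace.inner_eq_star_dotProduct]
    simp only [star_trivial]
    rw [dotProduct_comm, Matrix.dotProduct_mulVec, ← Matrix.mulVec_transpose, hT, h2,
      smul_dotProduct, dotProduct_comm, smul_eq_mul]
  rw [h, norm_mul, mul_pow]
  gcongr
  rw [Real.norm_of_nonneg (hA.eigenvalues_nonneg i)]
  exact hL i

theorem stmt16 {n d k : ℕ} (hn : 0 < n) (hd : 0 < d) (hk : 1 ≤ k) (hkd : k ≤ d)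
    (U : Matrix (Fin n) (Fin k) ℝ)
    (V : Matrix (Fin d) (Fin k) ℝ) (hV : Vᵀ * V = 1)
    (P : Matrix (Fin d) (Fin (d - k)) ℝ) (hP : Pᵀ * P = 1)
    (x : Fin k → ℝ) (hx : ∑ i, x i ^ 2 = 1) :
    sigMinSq U * specNorm (Pᵀ * V) ^ 2 -
        Real.sqrt ((k : ℝ) - 1) * frobNorm U ^ 2 * specNorm (Pᵀ * V) ^ 2 ≤
      Matrix.trace (P * Pᵀ * V * Matrix.vecMulVec x x * Uᵀ * U * Vᵀ) := by
  rw [aux_trace]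
  set W := Pᵀ * V
  have hxn : ‖WithLp.toLp 2 x‖ = 1 := by
    rw [EuclideanSpace.norm_eq]; simp [hx]
  have hnn := (aux_herm U).eigenvalues_nonneg
  set e := (aux_herm U).isHermitian.eigenvalues with he
  have hs0 : 0 ≤ specNorm W := norm_nonneg _
  rcases hk.eq_or_lt with h1 | h1
  · subst h1
    have hx0 : x 0 ^ 2 = 1 := by simpa using hx
    have hA : frobNorm U ^ 2 = (Uᵀ * U) 0 0 := by rw [aux_frob]; simp [Matrix.trace]
    have hsA : sigMinSq U ≤ (Uᵀ * U) 0 0 := by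
      rw [← hA, aux_tr]; simpa using aux_sig U 0
    have hA0 : 0 ≤ (Uᵀ * U) 0 0 := by rw [← hA]; positivity
    have hW : specNorm W ^ 2 ≤ ∑ i, W i 0 ^ 2 := by
      have : specNorm W ≤ Real.sqrt (∑ i, W i 0 ^ 2) := by
        apply ContinuousLinearMap.opNorm_le_bound _ (Real.sqrt_nonneg _)
        intro y
        apply le_of_eq
        rw [EuclideanSpace.norm_eq, EuclideanSpace.norm_eq, ← Real.sqrt_mul (by positivity)]
        congr 1
        simp [Matrix.toLpLin_apply, Matrix.mulVec, dotProduct, mul_pow, Finset.sum_mul]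
      calc _ ≤ Real.sqrt (∑ i, W i 0 ^ 2) ^ 2 := by gcongr
        _ = _ := Real.sq_sqrt (by positivity)
    have hR : (W *ᵥ ((Uᵀ * U) *ᵥ x)) ⬝ᵥ (W *ᵥ x) = (Uᵀ * U) 0 0 * ∑ i, W i 0 ^ 2 := by
      simp only [Matrix.mulVec, dotProduct, Fin.sum_univ_one, Finset.univ_unique,
        Finset.sum_singleton, Fin.default_eq_zero, Finset.mul_sum]
      refine Finset.sum_congr rfl fun i _ => ?_
      linear_combination ((Uᵀ * U) 0 0 * W i 0 ^ 2) * hx0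
    rw [hR]
    simp only [Nat.cast_one, sub_self, Real.sqrt_zero, zero_mul, sub_zero]
    calc _ ≤ (Uᵀ * U) 0 0 * specNorm W ^ 2 := by gcongr
      _ ≤ _ := by gcongr
  · haveI : Nonempty (Fin k) := ⟨⟨0, by omega⟩⟩
    haveI : Nontrivial (Fin k) := Fin.nontrivial_iff_two_le.mpr h1
    obtain ⟨i, hi⟩ := Finite.exists_max e
    obtain ⟨j, hj⟩ := exists_ne i
    have ht : e i + e j ≤ frobNorm U ^ 2 := by
      rw [aux_tr, ← Finset.sum_pair hj.symm]
      exact Finset.sum_le_sum_of_subset_of_nonneg (Finset.subset_univ _) fun l _ _ => hnn l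
    have hsj := aux_sig U j
    have hk2 : (2 : ℝ) ≤ k := by exact_mod_cast h1
    have hsq : 1 ≤ Real.sqrt ((k : ℝ) - 1) := Real.one_le_sqrt.mpr (by linarith)
    have hAx := aux_eig _ (aux_herm U) (e i) hi (hnn i) x
    have hWx := aux_spec W x
    have hWA := aux_spec W ((Uᵀ * U) *ᵥ x)
    rw [hxn, mul_one] at hAx hWx
    have hcs := abs_real_inner_le_norm (WithLp.toLp 2 (W *ᵥ x))
      (WithLp.toLp 2 (W *ᵥ ((Uᵀ * U) *ᵥ x)))
    rw [EuclideanSpace.inner_eq_star_dotProduct] at hcs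
    simp only [star_trivial] at hcs
    have hlow := (abs_le.mp hcs).1
    have hb : ‖WithLp.toLp 2 (W *ᵥ x)‖ * ‖WithLp.toLp 2 (W *ᵥ ((Uᵀ * U) *ᵥ x))‖ ≤
        specNorm W * (specNorm W * e i) := by
      gcongr
      exact hWA.trans (by gcongr)
    have hf : frobNorm U ^ 2 ≤ Real.sqrt ((k : ℝ) - 1) * frobNorm U ^ 2 :=
      le_mul_of_one_le_left (by positivity) hsq
    have hfin : (sigMinSq U - Real.sqrt ((k : ℝ) - 1) * frobNorm U ^ 2) * specNorm W ^ 2 ≤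
        (- e i) * specNorm W ^ 2 := by
      apply mul_le_mul_of_nonneg_right _ (by positivity)
      linarith
    linarith
end
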